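/- arXiv:1401.2529 — 4 statements merged into one kernel-verified Lean document; each statement's English description precedes it below -/
import Mathlib

section
/- Under the stated setup, the parameter-domain distance between the optimal transformation λ_o and its tangent distance estimate λ_e satisfies ‖λ_e − λ_o‖ ≤ K · η_min(G(λ_r))⁻¹ · ( (1/2)·√(tr(G(λ_r)))·‖λ_o − λ_r‖₁² + √d · ν · ‖λ_o − λ_r‖₁ ). -/
open scoped RealInnerProductSpace BigOperators

/-- The `i`-th partial derivative `∂ᵢp(x) ∈ H` of a map `p : ℝᵈ → H`. -/
noncomputable def pderiv {H : Type*} [NormedAddCommGroup H] [NormedSpace ℝ H] {d : ℕ}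
    (p : EuclideanSpace ℝ (Fin d) → H) (i : Fin d) (x : EuclideanSpace ℝ (Fin d)) : H :=
  fderiv ℝ p x (EuclideanSpace.single i 1)

/-- The second partial derivative `∂ᵢⱼp(x) ∈ H`. -/
noncomputable def pderiv2 {H : Type*} [NormedAddCommGroup H] [NormedSpace ℝ H] {d : ℕ}
    (p : EuclideanSpace ℝ (Fin d) → H) (i j : Fin d) (x : EuclideanSpace ℝ (Fin d)) : H :=
  fderiv ℝ (fun y => pderiv p j y) x (EuclideanSpace.single i 1)

/-- The Gram (metric) matrix `G(x)ᵢⱼ = ⟨∂ᵢp(x), ∂ⱼp(x)⟩`. -/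
noncomputable def gram {H : Type*} [NormedAddCommGroup H] [InnerProductSpace ℝ H] {d : ℕ}
    (p : EuclideanSpace ℝ (Fin d) → H) (x : EuclideanSpace ℝ (Fin d)) :
    Matrix (Fin d) (Fin d) ℝ :=
  Matrix.of fun i j => ⟪pderiv p i x, pderiv p j x⟫

/-- Smallest eigenvalue of a symmetric real matrix. -/
noncomputable def etaMin {d : ℕ} (A : Matrix (Fin d) (Fin d) ℝ) : ℝ :=
  if h : A.IsHermitian then ⨅ i, h.eigenvalues i else 0

theorem ContinuousLinearMap.apply_eq_sum_single
    {F : Type*} [NormedAddCommGroup F] [NormedSpace ℝ F] {d : ℕ}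
    (L : EuclideanSpace ℝ (Fin d) →L[ℝ] F) (v : EuclideanSpace ℝ (Fin d)) :
    L v = ∑ i, v i • L (EuclideanSpace.single i 1) := by
  have hv : v = ∑ i, v i • EuclideanSpace.single i (1 : ℝ) := by
    ext j
    simp [Pi.single_apply]
  conv_lhs => rw [hv]
  simp

/-- A bound on the partial derivatives makes the map Lipschitz with respect to the `ℓ¹` norm. -/
theorem norm_sub_le_of_norm_pderiv_le {F : Type*} [NormedAddCommGroup F] [NormedSpace ℝ F] {d : ℕ}
    {f : EuclideanSpace ℝ (Fin d) → F} (hf : Differentiable ℝ f) {K : ℝ}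
    (hK : ∀ x i, ‖pderiv f i x‖ ≤ K) (x v : EuclideanSpace ℝ (Fin d)) :
    ‖f (x + v) - f x‖ ≤ K * ∑ i, |v i| := by
  have hd : ∀ t : ℝ, HasDerivAt (fun t : ℝ => f (x + t • v)) (fderiv ℝ f (x + t • v) v) t := by
    intro t
    have hl : HasDerivAt (fun t : ℝ => x + t • v) v t := by
      simpa using ((hasDerivAt_id t).smul_const v).const_add x
    exact (hf _).hasFDerivAt.comp_hasDerivAt t hl
  have hb : ∀ t : ℝ, ‖fderiv ℝ f (x + t • v) v‖ ≤ K * ∑ i, |v i| := by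
    intro t
    rw [ContinuousLinearMap.apply_eq_sum_single, Finset.mul_sum]
    refine norm_sum_le_of_le _ fun i _ => ?_
    rw [norm_smul, Real.norm_eq_abs, mul_comm]
    exact mul_le_mul_of_nonneg_right (hK _ i) (abs_nonneg _)
  simpa using norm_image_sub_le_of_norm_deriv_le_segment_01'
    (fun t _ => (hd t).hasDerivWithinAt) (fun t _ => hb t)

theorem differentiable_pderiv {F : Type*} [NormedAddCommGroup F] [NormedSpace ℝ F] {d : ℕ}
    {f : EuclideanSpace ℝ (Fin d) → F} (hf : ContDiff ℝ 2 f) (i : Fin d) :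
    Differentiable ℝ (pderiv f i) :=
  ((hf.fderiv_right (m := 1) (by norm_num)).clm_apply contDiff_const).differentiable (by norm_num)

/-- First-order Taylor remainder bound in terms of the `ℓ¹` norm. -/
theorem norm_taylor_remainder_le {F : Type*} [NormedAddCommGroup F] [NormedSpace ℝ F] {d : ℕ}
    {f : EuclideanSpace ℝ (Fin d) → F} (hf : ContDiff ℝ 2 f) {K : ℝ}
    (hK : ∀ x i j, ‖pderiv2 f i j x‖ ≤ K) (x v : EuclideanSpace ℝ (Fin d)) :
    ‖f (x + v) - f x - fderiv ℝ f x v‖ ≤ K / 2 * (∑ i, |v i|) ^ 2 := by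
  have hp := differentiable_pderiv hf
  have hdiff : Differentiable ℝ f := hf.differentiable (by norm_num)
  set S := ∑ i, |v i| with hS
  have hd : ∀ t : ℝ, HasDerivAt (fun t : ℝ => f (x + t • v) - f x - t • fderiv ℝ f x v)
      (fderiv ℝ f (x + t • v) v - fderiv ℝ f x v) t := by
    intro t
    have hl : HasDerivAt (fun t : ℝ => x + t • v) v t := by
      simpa using ((hasDerivAt_id t).smul_const v).const_add x
    have h1 := (hdiff (x + t • v)).hasFDerivAt.comp_hasDerivAt t hl
    have h2 := (h1.sub_const (f x)).sub ((hasDerivAt_id t).smul_const (fderiv ℝ f x v))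
    rw [one_smul] at h2
    exact h2
  have hb : ∀ t ∈ Set.Ico (0 : ℝ) 1,
      ‖fderiv ℝ f (x + t • v) v - fderiv ℝ f x v‖ ≤ K * S ^ 2 * t := by
    intro t ht
    rw [ContinuousLinearMap.apply_eq_sum_single _ v, ContinuousLinearMap.apply_eq_sum_single (fderiv ℝ f x) v,
      ← Finset.sum_sub_distrib]
    have hrw : K * S ^ 2 * t = ∑ i, |v i| * (K * (t * S)) := by
      rw [← Finset.sum_mul, ← hS]; ring
    rw [hrw]
    refine norm_sum_le_of_le _ fun i _ => ?_
    rw [← smul_sub, norm_smul, Real.norm_eq_abs]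
    refine mul_le_mul_of_nonneg_left ?_ (abs_nonneg _)
    have h := norm_sub_le_of_norm_pderiv_le (hp i) (fun y j => hK y j i) x (t • v)
    simpa [pderiv, abs_mul, abs_of_nonneg ht.1, ← Finset.mul_sum, ← hS] using h
  have hB : ∀ t : ℝ, HasDerivAt (fun t : ℝ => K * S ^ 2 / 2 * t ^ 2) (K * S ^ 2 * t) t := by
    intro t
    have h := (hasDerivAt_pow 2 t).const_mul (K * S ^ 2 / 2)
    exact h.congr_deriv (by push_cast; ring)
  have h := image_norm_le_of_norm_deriv_right_le_deriv_boundary (a := (0 : ℝ)) (b := 1)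
    (fun t _ => (hd t).continuousAt.continuousWithinAt)
    (fun t _ => (hd t).hasDerivWithinAt) (by simp) hB hb
    (Set.right_mem_Icc.2 zero_le_one)
  simp only [one_smul, one_pow, mul_one] at h
  linarith

theorem etaMin_pos {d : ℕ} (hd : 0 < d) {A : Matrix (Fin d) (Fin d) ℝ} (hA : A.PosDef) :
    0 < etaMin A := by
  have : Nonempty (Fin d) := ⟨⟨0, hd⟩⟩
  rw [etaMin, dif_pos hA.isHermitian]
  obtain ⟨i, hi⟩ := exists_eq_ciInf_of_finite (f := hA.isHermitian.eigenvalues)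
  rw [← hi]
  exact hA.eigenvalues_pos i

theorem etaMin_mul_norm_sq_le {d : ℕ} {A : Matrix (Fin d) (Fin d) ℝ} (hA : A.IsHermitian)
    (w : EuclideanSpace ℝ (Fin d)) :
    etaMin A * ‖w‖ ^ 2 ≤ ⟪w, A.toEuclideanLin w⟫ := by
  rw [etaMin, dif_pos hA]
  set b := hA.eigenvectorBasis
  have hsym := Matrix.isSymmetric_toEuclideanLin_iff.2 hA
  have hev : ∀ i, A.toEuclideanLin (b i) = hA.eigenvalues i • b i := by
    intro i
    ext j
    simpa using congrFun (hA.mulVec_eigenvectorBasis i) j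
  rw [← b.sum_inner_mul_inner, ← real_inner_self_eq_norm_sq, ← b.sum_inner_mul_inner,
    Finset.mul_sum]
  refine Finset.sum_le_sum fun i _ => ?_
  rw [← hsym, hev, real_inner_smul_left, real_inner_comm (b i) w]
  have h1 : ⨅ i, hA.eigenvalues i ≤ hA.eigenvalues i := ciInf_le (Set.finite_range _).bddBelow i
  nlinarith [mul_le_mul_of_nonneg_right h1 (mul_self_nonneg ⟪w, b i⟫)]

/-- The smallest eigenvalue bounds from below how much a symmetric matrix stretches vectors. -/
theorem etaMin_mul_norm_le {d : ℕ} {A : Matrix (Fin d) (Fin d) ℝ} (hA : A.IsHermitian)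
    (w : EuclideanSpace ℝ (Fin d)) :
    etaMin A * ‖w‖ ≤ ‖A.toEuclideanLin w‖ := by
  rcases (norm_nonneg w).eq_or_lt with h0 | h0
  · rw [← h0, mul_zero]
    exact norm_nonneg _
  · refine le_of_mul_le_mul_left ?_ h0
    nlinarith [etaMin_mul_norm_sq_le hA w, real_inner_le_norm w (A.toEuclideanLin w)]

theorem norm_toLp_inner_le {H : Type*} [NormedAddCommGroup H] [InnerProductSpace ℝ H] {d : ℕ}
    (u : H) (e : Fin d → H) :
    ‖WithLp.toLp 2 (fun j => ⟪u, e j⟫)‖ ≤ ‖u‖ * Real.sqrt (∑ j, ‖e j‖ ^ 2) := by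
  rw [EuclideanSpace.norm_eq]
  refine Real.sqrt_le_iff.2 ⟨by positivity, ?_⟩
  rw [mul_pow, Real.sq_sqrt (by positivity), Finset.mul_sum]
  refine Finset.sum_le_sum fun j _ => ?_
  rw [← mul_pow]
  exact pow_le_pow_left₀ (norm_nonneg _) (norm_inner_le_norm u (e j)) 2

theorem gram_trace {H : Type*} [NormedAddCommGroup H] [InnerProductSpace ℝ H] {d : ℕ}
    (p : EuclideanSpace ℝ (Fin d) → H) (x : EuclideanSpace ℝ (Fin d)) :
    (gram p x).trace = ∑ j, ‖pderiv p j x‖ ^ 2 := by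
  simp [gram, Matrix.trace]

theorem gram_toEuclideanLin_apply {H : Type*} [NormedAddCommGroup H] [InnerProductSpace ℝ H]
    {d : ℕ} (p : EuclideanSpace ℝ (Fin d) → H) (x v : EuclideanSpace ℝ (Fin d)) (j : Fin d) :
    (gram p x).toEuclideanLin v j = ⟪fderiv ℝ p x v, pderiv p j x⟫ := by
  rw [ContinuousLinearMap.apply_eq_sum_single, sum_inner]
  simp only [Matrix.toLpLin_apply, Matrix.mulVec, dotProduct, gram, Matrix.of_apply,
    real_inner_smul_left]
  refine Finset.sum_congr rfl fun i _ => ?_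
  rw [real_inner_comm, mul_comm]
  rfl

/-- Theorem 1 (alignment error bound for the tangent distance method). -/
theorem tangent_distance_alignment_error_bound
    {H : Type*} [NormedAddCommGroup H] [InnerProductSpace ℝ H]
    {d : ℕ} (hd : 0 < d)
    (p : EuclideanSpace ℝ (Fin d) → H) (hp : ContDiff ℝ 2 p)
    (K : ℝ) (hK : 0 ≤ K)
    (hKb : ∀ (x : EuclideanSpace ℝ (Fin d)) (i j : Fin d), ‖pderiv2 p i j x‖ ≤ K)
    (lr lo : EuclideanSpace ℝ (Fin d))
    (hPD : (gram p lr).PosDef)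
    (n : H) (hn : ∀ i, ⟪n, pderiv p i lo⟫ = 0)
    (ν : ℝ) (hν : ν = ‖n‖)
    (q : H) (hq : q = p lo + n)
    (lE : EuclideanSpace ℝ (Fin d))
    (hlE : ∀ i, lE i = lr i + ∑ j, (gram p lr)⁻¹ i j * ⟪q - p lr, pderiv p j lr⟫) :
    ‖lE - lo‖ ≤ K * (etaMin (gram p lr))⁻¹ *
      (1 / 2 * Real.sqrt (gram p lr).trace * (∑ i, |lo i - lr i|) ^ 2
        + Real.sqrt (d : ℝ) * ν * ∑ i, |lo i - lr i|) := by
  have hG := hPD.isHermitian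
  have hη := etaMin_pos hd hPD
  subst hν
  set v := lo - lr with hv
  have hlo : lr + v = lo := by rw [hv]; abel
  set S := ∑ i, |lo i - lr i| with hS
  have hSv : ∑ i, |v i| = S := rfl
  set R := p lo - p lr - fderiv ℝ p lr v with hR
  have hRle : ‖R‖ ≤ K / 2 * S ^ 2 := by
    have h := norm_taylor_remainder_le hp hKb lr v
    rwa [hlo, hSv] at h
  have hD : ∀ j, ‖pderiv p j lr - pderiv p j lo‖ ≤ K * S := by
    intro j
    have h := norm_sub_le_of_norm_pderiv_le (differentiable_pderiv hp j)
      (fun y i => hKb y i j) lr v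
    rwa [hlo, hSv, norm_sub_rev] at h
  have hest : (gram p lr).toEuclideanLin (lE - lr) =
      WithLp.toLp 2 (fun j => ⟪q - p lr, pderiv p j lr⟫) := by
    have hE : (lE - lr).ofLp =
        (gram p lr)⁻¹.mulVec (fun j => ⟪q - p lr, pderiv p j lr⟫) := by
      funext i
      simp [hlE i, Matrix.mulVec, dotProduct]
    rw [Matrix.toLpLin_apply, hE, Matrix.mulVec_mulVec,
      Matrix.mul_nonsing_inv _ ((Matrix.isUnit_iff_isUnit_det _).1 hPD.isUnit),
      Matrix.one_mulVec]
  have hdecomp : (gram p lr).toEuclideanLin (lE - lo) =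
      WithLp.toLp 2 (fun j => ⟪R, pderiv p j lr⟫) +
        WithLp.toLp 2 (fun j => ⟪n, pderiv p j lr - pderiv p j lo⟫) := by
    have hsub : lE - lo = (lE - lr) - v := by rw [hv]; abel
    rw [hsub, map_sub, hest]
    ext j
    simp only [PiLp.sub_apply, PiLp.add_apply, gram_toEuclideanLin_apply]
    rw [inner_sub_right, hn j, sub_zero, ← inner_sub_left, ← inner_add_left, hq, hR]
    congr 1
    abel
  have hnoise : √(∑ j, ‖pderiv p j lr - pderiv p j lo‖ ^ 2) ≤ √(d : ℝ) * (K * S) := by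
    have hS0 : 0 ≤ S := Finset.sum_nonneg fun i _ => abs_nonneg _
    refine Real.sqrt_le_iff.2 ⟨by positivity, ?_⟩
    rw [mul_pow, Real.sq_sqrt (Nat.cast_nonneg d)]
    calc ∑ j, ‖pderiv p j lr - pderiv p j lo‖ ^ 2 ≤ ∑ _j : Fin d, (K * S) ^ 2 :=
          Finset.sum_le_sum fun j _ => pow_le_pow_left₀ (norm_nonneg _) (hD j) 2
      _ = d * (K * S) ^ 2 := by simp
  have hmain : etaMin (gram p lr) * ‖lE - lo‖ ≤
      K / 2 * S ^ 2 * √(gram p lr).trace + ‖n‖ * (√(d : ℝ) * (K * S)) := by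
    refine (etaMin_mul_norm_le hG _).trans ?_
    rw [hdecomp, gram_trace]
    refine (norm_add_le _ _).trans (add_le_add ?_ ?_)
    · exact (norm_toLp_inner_le _ _).trans
        (mul_le_mul_of_nonneg_right hRle (Real.sqrt_nonneg _))
    · exact (norm_toLp_inner_le _ _).trans
        (mul_le_mul_of_nonneg_left hnoise (norm_nonneg _))
  calc ‖lE - lo‖ ≤ (etaMin (gram p lr))⁻¹ *
        (K / 2 * S ^ 2 * √(gram p lr).trace + ‖n‖ * (√(d : ℝ) * (K * S))) :=
        (le_inv_mul_iff₀ hη).2 hmain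
    _ = _ := by ring
end

section
/- Let φ(X) = exp(−XᵀX) on ℝ², and for k = j, k let φ_{γ_j}, φ_{γ_k} be Gaussian atoms φ_{γ}(X) = φ(σ⁻¹ Ψ⁻¹ (X − τ)) with diagonal scales σ_j, σ_k (positive diagonal entries), rotations Ψ_j, Ψ_k, and translations τ_j, τ_k ∈ ℝ². Then ∫_{ℝ²} φ_{γ_j}(X) φ_{γ_k}(X) dX = Q_{jk}/2, where Σ_{jk} := (1/2)(Ψ_j σ_j² Ψ_j⁻¹ + Ψ_k σ_k² Ψ_k⁻¹) and Q_{jk} := (π |σ_j| |σ_k| / √(det Σ_{jk})) · exp( −(1/2) (τ_k − τ_j)ᵀ Σ_{jk}⁻¹ (τ_k − τ_j) ), with |σ| the determinant of the diagonal scale matrix. -/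
open MeasureTheory Matrix
open scoped BigOperators

/-- The Gaussian mother function `φ(X) = exp(−XᵀX)` on `ℝ²`. -/
noncomputable def gphi (X : Fin 2 → ℝ) : ℝ := Real.exp (-(X ⬝ᵥ X))

/-- A Gaussian atom `φ_γ(X) = φ(σ⁻¹ Ψ⁻¹ (X − τ))` with scale `σ`, rotation `Ψ`,
and translation `τ`. -/
noncomputable def gatom (σ Ψ : Matrix (Fin 2) (Fin 2) ℝ) (τ : Fin 2 → ℝ)
    (X : Fin 2 → ℝ) : ℝ :=
  gphi (σ⁻¹ *ᵥ (Ψ⁻¹ *ᵥ (X - τ)))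

/-- `Ψ` is a 2×2 rotation matrix. -/
def IsRotation (Ψ : Matrix (Fin 2) (Fin 2) ℝ) : Prop := Ψᵀ * Ψ = 1 ∧ Ψ.det = 1

/-- The integral of a centred Gaussian with positive definite precision matrix. -/
theorem Matrix.PosDef.integral_exp_neg_dotProduct_mulVec {ι : Type*} [Fintype ι] [DecidableEq ι]
    {A : Matrix ι ι ℝ} (hA : A.PosDef) :
    ∫ x : ι → ℝ, Real.exp (-(x ⬝ᵥ A *ᵥ x)) =
      Real.sqrt Real.pi ^ Fintype.card ι / Real.sqrt A.det := by
  obtain ⟨B, rfl⟩ : ∃ B : Matrix ι ι ℝ, A = Bᵀ * B := by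
    open scoped MatrixOrder in
    obtain ⟨B, hB⟩ := CStarAlgebra.nonneg_iff_eq_star_mul_self.mp hA.posSemidef.nonneg
    exact ⟨B, by simpa [star_eq_conjTranspose] using hB⟩
  have hdet : B.det ≠ 0 := fun h ↦ hA.det_pos.ne' (by simp [h])
  have hquad (x : ι → ℝ) : x ⬝ᵥ (Bᵀ * B) *ᵥ x = (B *ᵥ x) ⬝ᵥ (B *ᵥ x) := by
    rw [← mulVec_mulVec, dotProduct_mulVec, vecMul_transpose]
  have hstd : ∫ x : ι → ℝ, Real.exp (-(x ⬝ᵥ x)) = Real.sqrt Real.pi ^ Fintype.card ι := by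
    have h := integral_fintype_prod_volume_eq_pow (ι := ι) (fun t : ℝ ↦ Real.exp (-1 * t ^ 2))
    rw [integral_gaussian, div_one] at h
    rw [← h]
    congr with x
    simp [← Real.exp_sum, dotProduct, sq]
  have hemb : MeasurableEmbedding (toLin' B) :=
    (LinearMap.continuous_on_pi _).measurableEmbedding <|
      mulVec_injective_iff_isUnit.2 ((isUnit_iff_isUnit_det _).2 hdet.isUnit)
  have hmap := hemb.integral_map (μ := volume) (fun x : ι → ℝ ↦ Real.exp (-(x ⬝ᵥ x)))
  rw [Real.map_matrix_volume_pi_eq_smul_volume_pi hdet, integral_smul_measure, hstd] at hmap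
  simp only [toLin'_apply] at hmap
  simp_rw [hquad]
  rw [← hmap, ENNReal.toReal_ofReal (abs_nonneg _), det_mul, det_transpose,
    Real.sqrt_mul_self_eq_abs, abs_inv, smul_eq_mul]
  ring

/-- Completing the square: the sum of two quadratic forms with precision matrices `P⁻¹` and `R⁻¹`
centred at `s` and `t` is a recentred form with matrix `P⁻¹ + R⁻¹` plus a constant. -/
theorem dotProduct_mulVec_add_completeSquare {ι : Type*} [Fintype ι] [DecidableEq ι]
    {P R : Matrix ι ι ℝ} (hP : P.PosDef) (hR : R.PosDef) (s t x : ι → ℝ) :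
    (x - s) ⬝ᵥ P⁻¹ *ᵥ (x - s) + (x - t) ⬝ᵥ R⁻¹ *ᵥ (x - t) =
      (x - (s + ((P⁻¹ + R⁻¹)⁻¹ * R⁻¹) *ᵥ (t - s))) ⬝ᵥ (P⁻¹ + R⁻¹) *ᵥ
        (x - (s + ((P⁻¹ + R⁻¹)⁻¹ * R⁻¹) *ᵥ (t - s))) + (t - s) ⬝ᵥ (P + R)⁻¹ *ᵥ (t - s) := by
  have hA := hP.inv.add hR.inv
  have hsymm {M : Matrix ι ι ℝ} (hM : M.PosDef) (u v : ι → ℝ) :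
      u ⬝ᵥ M *ᵥ v = v ⬝ᵥ M *ᵥ u := by
    have h : Mᵀ = M := by simpa using hM.isHermitian.eq
    rw [dotProduct_mulVec, dotProduct_comm, ← mulVec_transpose, h]
  obtain ⟨y, rfl⟩ : ∃ y, x = s + y := ⟨x - s, by simp⟩
  obtain ⟨d, rfl⟩ : ∃ d, t = s + d := ⟨t - s, by simp⟩
  simp only [add_sub_cancel_left, add_sub_add_left_eq_sub]
  have hAw : (P⁻¹ + R⁻¹) *ᵥ ((P⁻¹ + R⁻¹)⁻¹ * R⁻¹) *ᵥ d = R⁻¹ *ᵥ d := by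
    rw [mulVec_mulVec, mul_nonsing_inv_cancel_left _ _ hA.det_pos.ne'.isUnit]
  generalize ((P⁻¹ + R⁻¹)⁻¹ * R⁻¹) *ᵥ d = w at hAw ⊢
  have hrem : (P + R)⁻¹ *ᵥ d = R⁻¹ *ᵥ (d - w) := by
    have hPw : R⁻¹ *ᵥ (d - w) = P⁻¹ *ᵥ w := by
      rw [mulVec_sub, ← hAw, add_mulVec, add_sub_cancel_right]
    have hd : (P + R) *ᵥ R⁻¹ *ᵥ (d - w) = d := by
      rw [add_mulVec]
      nth_rewrite 1 [hPw]
      rw [mulVec_mulVec, mulVec_mulVec, mul_nonsing_inv _ hP.det_pos.ne'.isUnit,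
        mul_nonsing_inv _ hR.det_pos.ne'.isUnit, one_mulVec, one_mulVec, add_sub_cancel]
    nth_rewrite 1 [← hd]
    rw [mulVec_mulVec, nonsing_inv_mul _ (hP.add hR).det_pos.ne'.isUnit, one_mulVec]
  have hyA : y ⬝ᵥ (P⁻¹ + R⁻¹) *ᵥ y = y ⬝ᵥ P⁻¹ *ᵥ y + y ⬝ᵥ R⁻¹ *ᵥ y := by
    rw [add_mulVec, dotProduct_add]
  simp only [hrem, mulVec_sub, dotProduct_sub, sub_dotProduct, hAw, hyA, hsymm hA w y,
    hsymm hR.inv d y, hsymm hR.inv d w]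
  ring

/-- The integral of the product of two Gaussians with covariance matrices proportional to
`P` and `R`. -/
theorem integral_exp_neg_mul_exp_neg {ι : Type*} [Fintype ι] [DecidableEq ι]
    {P R : Matrix ι ι ℝ} (hP : P.PosDef) (hR : R.PosDef) (s t : ι → ℝ) :
    ∫ x : ι → ℝ, Real.exp (-((x - s) ⬝ᵥ P⁻¹ *ᵥ (x - s))) *
        Real.exp (-((x - t) ⬝ᵥ R⁻¹ *ᵥ (x - t))) =
      Real.sqrt Real.pi ^ Fintype.card ι / Real.sqrt (P⁻¹ + R⁻¹).det *
        Real.exp (-((t - s) ⬝ᵥ (P + R)⁻¹ *ᵥ (t - s))) := by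
  simp_rw [← Real.exp_add, ← neg_add, dotProduct_mulVec_add_completeSquare hP hR, neg_add,
    Real.exp_add]
  rw [integral_mul_const, integral_sub_right_eq_self
    (fun x : ι → ℝ ↦ Real.exp (-(x ⬝ᵥ (P⁻¹ + R⁻¹) *ᵥ x))),
    (hP.inv.add hR.inv).integral_exp_neg_dotProduct_mulVec]

theorem IsRotation.inv_eq_transpose {Ψ : Matrix (Fin 2) (Fin 2) ℝ} (h : IsRotation Ψ) :
    Ψ⁻¹ = Ψᵀ := Matrix.inv_eq_left_inv h.1

theorem IsRotation.posDef_conj_diagonal_sq {Ψ : Matrix (Fin 2) (Fin 2) ℝ} (h : IsRotation Ψ)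
    {a : Fin 2 → ℝ} (ha : ∀ i, 0 < a i) : (Ψ * diagonal a ^ 2 * Ψ⁻¹).PosDef := by
  have hU : IsUnit Ψ := (isUnit_iff_isUnit_det _).2 (by simp [h.2])
  rw [h.inv_eq_transpose, ← conjTranspose_eq_transpose_of_trivial, ← star_eq_conjTranspose,
    hU.posDef_star_right_conjugate_iff, diagonal_pow]
  exact .diagonal fun i ↦ pow_pos (ha i) 2

theorem IsRotation.gatom_diagonal_eq {Ψ : Matrix (Fin 2) (Fin 2) ℝ} (h : IsRotation Ψ)
    (a τ X : Fin 2 → ℝ) :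
    gatom (diagonal a) Ψ τ X =
      Real.exp (-((X - τ) ⬝ᵥ (Ψ * diagonal a ^ 2 * Ψ⁻¹)⁻¹ *ᵥ (X - τ))) := by
  have hΨ : Ψ⁻¹⁻¹ = Ψ⁻¹ᵀ := by
    rw [nonsing_inv_nonsing_inv _ (by simp [h.2]), h.inv_eq_transpose, transpose_transpose]
  have hσ : (diagonal a)⁻¹ᵀ = (diagonal a)⁻¹ := by
    rw [transpose_nonsing_inv, diagonal_transpose]
  rw [gatom, gphi, Matrix.mul_inv_rev, Matrix.mul_inv_rev, hΨ, sq, Matrix.mul_inv_rev]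
  simp only [← mulVec_mulVec]
  rw [dotProduct_mulVec (X - τ), vecMul_transpose, dotProduct_mulVec _ (diagonal a)⁻¹,
    ← mulVec_transpose, hσ, dotProduct_comm]

/-- The integral of the product of two Gaussian atoms (Proposition 3). -/
theorem gaussian_atom_product_integral
    (σxj σyj σxk σyk : ℝ)
    (hjx : 0 < σxj) (hjy : 0 < σyj) (hkx : 0 < σxk) (hky : 0 < σyk)
    (Ψj Ψk : Matrix (Fin 2) (Fin 2) ℝ)
    (hΨj : IsRotation Ψj) (hΨk : IsRotation Ψk)
    (τj τk : Fin 2 → ℝ)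
    (σj σk : Matrix (Fin 2) (Fin 2) ℝ)
    (hσj : σj = Matrix.diagonal ![σxj, σyj])
    (hσk : σk = Matrix.diagonal ![σxk, σyk])
    (Sjk : Matrix (Fin 2) (Fin 2) ℝ)
    (hSjk : Sjk = (1 / 2 : ℝ) • (Ψj * σj ^ 2 * Ψj⁻¹ + Ψk * σk ^ 2 * Ψk⁻¹)) :
    ∫ X : Fin 2 → ℝ, gatom σj Ψj τj X * gatom σk Ψk τk X
      = (Real.pi * σj.det * σk.det / Real.sqrt Sjk.det
          * Real.exp (-(1 / 2) * ((τk - τj) ⬝ᵥ (Sjk⁻¹ *ᵥ (τk - τj))))) / 2 := by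
  have hP := hΨj.posDef_conj_diagonal_sq (a := ![σxj, σyj]) (by simp [Fin.forall_fin_two, *])
  have hR := hΨk.posDef_conj_diagonal_sq (a := ![σxk, σyk]) (by simp [Fin.forall_fin_two, *])
  have hdj : 0 < σj.det := by simp [hσj, hjx, hjy]
  have hdk : 0 < σk.det := by simp [hσk, hkx, hky]
  have hPdet : (Ψj * σj ^ 2 * Ψj⁻¹).det = σj.det ^ 2 := by
    simp [hΨj.inv_eq_transpose, hΨj.2]
  have hRdet : (Ψk * σk ^ 2 * Ψk⁻¹).det = σk.det ^ 2 := by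
    simp [hΨk.inv_eq_transpose, hΨk.2]
  rw [← hσj] at hP
  rw [← hσk] at hR
  have hj := hΨj.gatom_diagonal_eq ![σxj, σyj] τj
  have hk := hΨk.gatom_diagonal_eq ![σxk, σyk] τk
  rw [← hσj] at hj
  rw [← hσk] at hk
  simp_rw [hj, hk]
  rw [integral_exp_neg_mul_exp_neg hP hR]
  set P := Ψj * σj ^ 2 * Ψj⁻¹
  set R := Ψk * σk ^ 2 * Ψk⁻¹
  have hS : P + R = (2 : ℝ) • Sjk := by simp [hSjk, smul_smul]
  have hSpos : 0 < Sjk.det := by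
    rw [hSjk]; exact ((hP.add hR).smul (by norm_num)).det_pos
  have hinv : (P + R)⁻¹ = (1 / 2 : ℝ) • Sjk⁻¹ := by
    rw [hS]
    refine inv_eq_left_inv ?_
    simp [smul_smul, nonsing_inv_mul _ hSpos.ne'.isUnit]
  have hdet : (P⁻¹ + R⁻¹).det = (2 / (σj.det * σk.det)) ^ 2 * Sjk.det := by
    rw [Matrix.inv_add_inv (by simp [hP.isUnit, hR.isUnit]), hS]
    simp only [det_mul, det_nonsing_inv, Ring.inverse_eq_inv', det_smul, Fintype.card_fin,
      hPdet, hRdet]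
    field_simp
  rw [hdet, hinv, Real.sqrt_mul (sq_nonneg _), Real.sqrt_sq (by positivity), Fintype.card_fin,
    Real.sq_sqrt Real.pi_pos.le, smul_mulVec, dotProduct_smul, smul_eq_mul, neg_mul]
  have := Real.sqrt_pos.2 hSpos
  field_simp
end

section
/- Let ρ > 0, let φ_ρ(X) = exp(−‖X‖²/ρ²) be the isotropic Gaussian kernel of size ρ, and let φ_γ be a Gaussian atom with scale σ = diag(σ_x, σ_y), rotation Ψ, and translation τ. Then the unit-L¹-norm Gaussian filtering of the atom is again a Gaussian atom with the same rotation and translation and enlarged scales: (1/(π ρ²)) (φ_ρ * φ_γ)(X) = ( σ_x σ_y / √((ρ² + σ_x²)(ρ² + σ_y²)) ) · φ_{γ̂}(X), where φ_{γ̂}(X) = φ(σ̂⁻¹ Ψ⁻¹ (X − τ)) with σ̂ = diag(√(σ_x² + ρ²), √(σ_y² + ρ²)). -/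
open MeasureTheory Matrix
open scoped BigOperators

lemma integral_exp_neg_sq_div_mul_exp_neg_sub_sq_div (a : ℝ) {ρ s : ℝ} (hρ : 0 < ρ) (hs : 0 < s) :
    ∫ y : ℝ, Real.exp (-y ^ 2 / ρ ^ 2) * Real.exp (-(a - y) ^ 2 / s ^ 2) =
      √Real.pi * ρ * s / √(ρ ^ 2 + s ^ 2) * Real.exp (-a ^ 2 / (s ^ 2 + ρ ^ 2)) := by
  have complete_square (y : ℝ) :
      Real.exp (-y ^ 2 / ρ ^ 2) * Real.exp (-(a - y) ^ 2 / s ^ 2) =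
        Real.exp (-((ρ ^ 2 + s ^ 2) / (ρ * s) ^ 2) * (y - a * ρ ^ 2 / (ρ ^ 2 + s ^ 2)) ^ 2) *
          Real.exp (-a ^ 2 / (s ^ 2 + ρ ^ 2)) := by
    rw [← Real.exp_add, ← Real.exp_add, add_comm (s ^ 2)]
    congr 1
    field_simp
    ring
  simp_rw [complete_square]
  rw [integral_mul_const, integral_sub_right_eq_self
    (fun y : ℝ => Real.exp (-((ρ ^ 2 + s ^ 2) / (ρ * s) ^ 2) * y ^ 2)), integral_gaussian,
    div_div_eq_mul_div, Real.sqrt_div (by positivity), Real.sqrt_mul Real.pi_pos.le,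
    Real.sqrt_sq (by positivity), mul_assoc √Real.pi]

lemma Matrix.inv_diagonal_pair_mulVec {s t : ℝ} (hs : s ≠ 0) (ht : t ≠ 0) (v : Fin 2 → ℝ) :
    (Matrix.diagonal ![s, t])⁻¹ *ᵥ v = ![v 0 / s, v 1 / t] := by
  have h : (Matrix.diagonal ![s, t])⁻¹ = Matrix.diagonal ![s⁻¹, t⁻¹] := by
    refine Matrix.inv_eq_left_inv ?_
    rw [Matrix.diagonal_mul_diagonal, ← Matrix.diagonal_one]
    congr 1
    ext i
    fin_cases i <;> simp [hs, ht]
  rw [h]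
  ext i
  fin_cases i <;> simp [Matrix.mulVec_diagonal, div_eq_inv_mul]

lemma gatom_diagonal_eq_mul {s t : ℝ} (hs : s ≠ 0) (ht : t ≠ 0)
    (Ψ : Matrix (Fin 2) (Fin 2) ℝ) (τ X : Fin 2 → ℝ) :
    gatom (Matrix.diagonal ![s, t]) Ψ τ X =
      Real.exp (-(Ψ⁻¹ *ᵥ (X - τ)) 0 ^ 2 / s ^ 2) *
        Real.exp (-(Ψ⁻¹ *ᵥ (X - τ)) 1 ^ 2 / t ^ 2) := by
  rw [gatom, gphi, Matrix.inv_diagonal_pair_mulVec hs ht, ← Real.exp_add]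
  congr 1
  simp [dotProduct, Fin.sum_univ_two]
  ring

lemma continuous_gatom (σ Ψ : Matrix (Fin 2) (Fin 2) ℝ) (τ : Fin 2 → ℝ) :
    Continuous (gatom σ Ψ τ) := by
  unfold gatom gphi
  fun_prop

lemma IsRotation.dotProduct_mulVec_self {Ψ : Matrix (Fin 2) (Fin 2) ℝ} (hΨ : IsRotation Ψ)
    (v : Fin 2 → ℝ) : (Ψ *ᵥ v) ⬝ᵥ (Ψ *ᵥ v) = v ⬝ᵥ v := by
  rw [Matrix.dotProduct_mulVec, ← Matrix.mulVec_transpose, Matrix.mulVec_mulVec, hΨ.1,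
    Matrix.one_mulVec]

lemma IsRotation.integral_comp_mulVec {Ψ : Matrix (Fin 2) (Fin 2) ℝ} (hΨ : IsRotation Ψ)
    {f : (Fin 2 → ℝ) → ℝ} (hf : Continuous f) :
    ∫ Z : Fin 2 → ℝ, f (Ψ *ᵥ Z) = ∫ Y : Fin 2 → ℝ, f Y := by
  have h := Real.map_matrix_volume_pi_eq_smul_volume_pi (M := Ψ) (by simp [hΨ.2])
  simp only [hΨ.2, inv_one, abs_one, ENNReal.ofReal_one, one_smul] at h
  conv_rhs => rw [← h]
  rw [integral_map (LinearMap.continuous_of_finiteDimensional _).aemeasurable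
    hf.aestronglyMeasurable]
  rfl

/-- Unit-L¹-norm Gaussian low-pass filtering of a Gaussian atom is again a Gaussian atom
with the same rotation and translation and enlarged scales. -/
theorem gaussian_filtering_of_atom
    (ρ σx σy : ℝ) (hρ : 0 < ρ) (hx : 0 < σx) (hy : 0 < σy)
    (Ψ : Matrix (Fin 2) (Fin 2) ℝ) (hΨ : IsRotation Ψ)
    (τ : Fin 2 → ℝ) (X : Fin 2 → ℝ) :
    (1 / (Real.pi * ρ ^ 2)) *
        ∫ Y : Fin 2 → ℝ,
          Real.exp (-(Y ⬝ᵥ Y) / ρ ^ 2) * gatom (Matrix.diagonal ![σx, σy]) Ψ τ (X - Y)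
      = σx * σy / Real.sqrt ((ρ ^ 2 + σx ^ 2) * (ρ ^ 2 + σy ^ 2)) *
          gatom (Matrix.diagonal ![Real.sqrt (σx ^ 2 + ρ ^ 2), Real.sqrt (σy ^ 2 + ρ ^ 2)])
            Ψ τ X := by
  have hcont := continuous_gatom (Matrix.diagonal ![σx, σy]) Ψ τ
  rw [← hΨ.integral_comp_mulVec (by fun_prop)]
  set W := Ψ⁻¹ *ᵥ (X - τ) with hW
  have hinv (Z : Fin 2 → ℝ) : Ψ⁻¹ *ᵥ (X - Ψ *ᵥ Z - τ) = W - Z := by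
    rw [sub_right_comm, Matrix.mulVec_sub, Matrix.mulVec_mulVec,
      Matrix.nonsing_inv_mul Ψ (by simp [hΨ.2]), Matrix.one_mulVec]
  let g : Fin 2 → ℝ → ℝ := fun i y =>
    Real.exp (-y ^ 2 / ρ ^ 2) * Real.exp (-(W i - y) ^ 2 / ![σx, σy] i ^ 2)
  have hg (Z : Fin 2 → ℝ) :
      Real.exp (-((Ψ *ᵥ Z) ⬝ᵥ (Ψ *ᵥ Z)) / ρ ^ 2) *
        gatom (Matrix.diagonal ![σx, σy]) Ψ τ (X - Ψ *ᵥ Z) = ∏ i, g i (Z i) := by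
    rw [hΨ.dotProduct_mulVec_self, gatom_diagonal_eq_mul hx.ne' hy.ne', hinv]
    simp only [g, Fin.prod_univ_two, ← Real.exp_add]
    congr 1
    simp [dotProduct, Fin.sum_univ_two]
    ring
  simp_rw [hg]
  rw [integral_fintype_prod_volume_eq_prod, Fin.prod_univ_two,
    gatom_diagonal_eq_mul (by positivity) (by positivity), ← hW,
    Real.sq_sqrt (by positivity), Real.sq_sqrt (by positivity), Real.sqrt_mul (by positivity)]
  simp only [g, Matrix.cons_val_zero, Matrix.cons_val_one,
    integral_exp_neg_sq_div_mul_exp_neg_sub_sq_div _ hρ hx,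
    integral_exp_neg_sq_div_mul_exp_neg_sub_sq_div _ hρ hy]
  have hpi : √Real.pi ^ 2 = Real.pi := Real.sq_sqrt Real.pi_pos.le
  rw [← hpi]
  simp only [Real.sqrt_sq (Real.sqrt_nonneg _)]
  field_simp
end

section
/- Let s_x, s_y, σ_x, σ_y, ρ > 0, let Ψ be a 2×2 rotation matrix and τ ∈ ℝ². Define a_x = s_x² σ_x² + ρ², b_x = s_x² (σ_x² + ρ²), a_y = s_y² σ_y² + ρ², b_y = s_y² (σ_y² + ρ²), and let f₁(X) = φ( diag(√a_x, √a_y)⁻¹ Ψ⁻¹ (X − τ) ) and f₂(X) = φ( diag(√b_x, √b_y)⁻¹ Ψ⁻¹ (X − τ) ), where φ(X) = exp(−XᵀX). Then ∫_{ℝ²} ( f₁(X) − f₂(X) )² dX = (π/2)·( √(a_x a_y) + √(b_x b_y) ) − 2π·√( (a_x a_y b_x b_y) / ((a_x + b_x)(a_y + b_y)) ). -/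
open MeasureTheory Matrix
open scoped BigOperators

/-- A multiplicatively separable Gaussian on the plane is integrable. -/
lemma integrable_exp_neg_quadratic {p q : ℝ} (hp : 0 < p) (hq : 0 < q) :
    Integrable (fun X : Fin 2 → ℝ => Real.exp (-(p * X 0 ^ 2 + q * X 1 ^ 2))) := by
  have h : Integrable (fun X : Fin 2 → ℝ => ∏ i, Real.exp (-(![p, q] i) * X i ^ 2)) :=
    Integrable.fintype_prod (f := fun i (x : ℝ) => Real.exp (-(![p, q] i) * x ^ 2)) fun i => by
      fin_cases i
      · exact integrable_exp_neg_mul_sq hp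
      · exact integrable_exp_neg_mul_sq hq
  refine h.congr (.of_forall fun X => ?_)
  simp only [Fin.prod_univ_two, ← Real.exp_add, Matrix.cons_val_zero, Matrix.cons_val_one]
  ring_nf

lemma integral_exp_neg_quadratic (p q : ℝ) :
    ∫ X : Fin 2 → ℝ, Real.exp (-(p * X 0 ^ 2 + q * X 1 ^ 2))
      = Real.sqrt (Real.pi / p) * Real.sqrt (Real.pi / q) := by
  have h := integral_fintype_prod_volume_eq_prod
    (fun (i : Fin 2) (x : ℝ) => Real.exp (-(![p, q] i) * x ^ 2))
  simp only [Fin.prod_univ_two, ← Real.exp_add, Matrix.cons_val_zero, Matrix.cons_val_one,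
    integral_gaussian] at h
  rw [← h]
  congr 1 with X
  ring_nf

/-- The integral of a continuous function is invariant under a linear change of variables
of determinant one followed by a translation. -/
lemma integral_comp_mulVec_sub {M : Matrix (Fin 2) (Fin 2) ℝ} (hM : M.det = 1)
    {g : (Fin 2 → ℝ) → ℝ} (hg : Continuous g) (τ : Fin 2 → ℝ) :
    ∫ X : Fin 2 → ℝ, g (M *ᵥ (X - τ)) = ∫ X, g X := by
  rw [integral_sub_right_eq_self (fun X => g (M *ᵥ X)) τ]
  have hmap := Real.map_matrix_volume_pi_eq_smul_volume_pi (M := M) (by simp [hM])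
  have hc : Continuous (Matrix.toLin' M) := LinearMap.continuous_of_finiteDimensional _
  have h := integral_map (μ := volume) hc.measurable.aemeasurable hg.aestronglyMeasurable
  rw [hmap] at h
  simpa [hM] using h.symm

lemma gphi_diagonal_inv_mulVec {a b : ℝ} (ha : 0 < a) (hb : 0 < b) (X : Fin 2 → ℝ) :
    gphi ((Matrix.diagonal ![Real.sqrt a, Real.sqrt b])⁻¹ *ᵥ X)
      = Real.exp (-(a⁻¹ * X 0 ^ 2 + b⁻¹ * X 1 ^ 2)) := by
  have hinv : (Matrix.diagonal ![Real.sqrt a, Real.sqrt b])⁻¹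
      = Matrix.diagonal ![(Real.sqrt a)⁻¹, (Real.sqrt b)⁻¹] := by
    apply Matrix.inv_eq_right_inv
    have h1 := (Real.sqrt_pos.2 ha).ne'
    have h2 := (Real.sqrt_pos.2 hb).ne'
    ext i j
    fin_cases i <;> fin_cases j <;> simp [h1, h2]
  have h1 : (Real.sqrt a)⁻¹ ^ 2 = a⁻¹ := by rw [inv_pow, Real.sq_sqrt ha.le]
  have h2 : (Real.sqrt b)⁻¹ ^ 2 = b⁻¹ := by rw [inv_pow, Real.sq_sqrt hb.le]
  simp only [gphi, hinv, dotProduct, Fin.sum_univ_two, Matrix.mulVec_diagonal,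
    Matrix.cons_val_zero, Matrix.cons_val_one]
  rw [← h1, ← h2]
  ring_nf

/-- Squared L² distance between two axis-aligned centred Gaussians on the plane. -/
lemma integral_sub_exp_neg_quadratic_sq {a b c d : ℝ}
    (ha : 0 < a) (hb : 0 < b) (hc : 0 < c) (hd : 0 < d) :
    ∫ X : Fin 2 → ℝ, (Real.exp (-(a⁻¹ * X 0 ^ 2 + b⁻¹ * X 1 ^ 2))
        - Real.exp (-(c⁻¹ * X 0 ^ 2 + d⁻¹ * X 1 ^ 2))) ^ 2
      = Real.pi / 2 * (Real.sqrt (a * b) + Real.sqrt (c * d))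
          - 2 * Real.pi * Real.sqrt (a * b * c * d / ((a + c) * (b + d))) := by
  have hexpand : ∀ X : Fin 2 → ℝ, (Real.exp (-(a⁻¹ * X 0 ^ 2 + b⁻¹ * X 1 ^ 2))
        - Real.exp (-(c⁻¹ * X 0 ^ 2 + d⁻¹ * X 1 ^ 2))) ^ 2
      = (Real.exp (-(2 * a⁻¹ * X 0 ^ 2 + 2 * b⁻¹ * X 1 ^ 2))
          + Real.exp (-(2 * c⁻¹ * X 0 ^ 2 + 2 * d⁻¹ * X 1 ^ 2)))
        - 2 * Real.exp (-((a⁻¹ + c⁻¹) * X 0 ^ 2 + (b⁻¹ + d⁻¹) * X 1 ^ 2)) := fun X => by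
    rw [sub_sq, ← Real.exp_nat_mul, ← Real.exp_nat_mul, mul_assoc, ← Real.exp_add]
    push_cast
    ring_nf
  have h1 := integrable_exp_neg_quadratic (p := 2 * a⁻¹) (q := 2 * b⁻¹)
    (by positivity) (by positivity)
  have h2 := integrable_exp_neg_quadratic (p := 2 * c⁻¹) (q := 2 * d⁻¹)
    (by positivity) (by positivity)
  have h3 := integrable_exp_neg_quadratic (p := a⁻¹ + c⁻¹) (q := b⁻¹ + d⁻¹)
    (by positivity) (by positivity)
  simp only [hexpand]
  rw [integral_sub (h1.fun_add h2) (h3.const_mul 2), integral_add h1 h2, integral_const_mul]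
  simp only [integral_exp_neg_quadratic]
  have key : ∀ {p q k m : ℝ}, 0 < p → 0 ≤ k → Real.pi / p * (Real.pi / q) = k ^ 2 * m →
      Real.sqrt (Real.pi / p) * Real.sqrt (Real.pi / q) = k * Real.sqrt m := by
    intro p q k m hp hk h
    rw [← Real.sqrt_mul (by positivity), h, Real.sqrt_mul (by positivity), Real.sqrt_sq hk]
  rw [key (k := Real.pi / 2) (m := a * b) (by positivity) (by positivity) (by field_simp),
    key (k := Real.pi / 2) (m := c * d) (by positivity) (by positivity) (by field_simp),
    key (k := Real.pi) (m := a * b * c * d / ((a + c) * (b + d))) (by positivity) (by positivity)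
      (by field_simp; ring)]
  ring

/-- Squared L² distance between the filtered-then-scaled and the scaled-then-filtered
Gaussian atoms, quantifying the non-commutativity of low-pass filtering and geometric
transformations involving a scale change. -/
theorem filtering_scaling_noncommutativity_L2_distance
    (sx sy σx σy ρ : ℝ)
    (hsx : 0 < sx) (hsy : 0 < sy) (hx : 0 < σx) (hy : 0 < σy) (hρ : 0 < ρ)
    (Ψ : Matrix (Fin 2) (Fin 2) ℝ) (hΨ : IsRotation Ψ)
    (τ : Fin 2 → ℝ)
    (ax bx ay b_y : ℝ)
    (hax : ax = sx ^ 2 * σx ^ 2 + ρ ^ 2) (hbx : bx = sx ^ 2 * (σx ^ 2 + ρ ^ 2))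
    (hay : ay = sy ^ 2 * σy ^ 2 + ρ ^ 2) (hby : b_y = sy ^ 2 * (σy ^ 2 + ρ ^ 2)) :
    ∫ X : Fin 2 → ℝ,
        (gatom (Matrix.diagonal ![Real.sqrt ax, Real.sqrt ay]) Ψ τ X
          - gatom (Matrix.diagonal ![Real.sqrt bx, Real.sqrt b_y]) Ψ τ X) ^ 2
      = Real.pi / 2 * (Real.sqrt (ax * ay) + Real.sqrt (bx * b_y))
          - 2 * Real.pi * Real.sqrt (ax * ay * bx * b_y / ((ax + bx) * (ay + b_y))) := by
  have hax' : 0 < ax := by rw [hax]; positivity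
  have hbx' : 0 < bx := by rw [hbx]; positivity
  have hay' : 0 < ay := by rw [hay]; positivity
  have hby' : 0 < b_y := by rw [hby]; positivity
  have hdet : Ψ⁻¹.det = 1 := by simp [Matrix.det_nonsing_inv, hΨ.2]
  simp only [gatom, gphi_diagonal_inv_mulVec hax' hay', gphi_diagonal_inv_mulVec hbx' hby']
  rw [← integral_sub_exp_neg_quadratic_sq hax' hay' hbx' hby']
  exact integral_comp_mulVec_sub hdet
    (g := fun X => (Real.exp (-(ax⁻¹ * X 0 ^ 2 + ay⁻¹ * X 1 ^ 2))
      - Real.exp (-(bx⁻¹ * X 0 ^ 2 + b_y⁻¹ * X 1 ^ 2))) ^ 2) (by fun_prop) τ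
end
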